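/- Let m, n ∈ ℕ and s, r', r'' ∈ ℝ satisfy s ≤ r' + min{0, r''} and s ≤ r'' + min{0, r'}. Let f ∈ 𝒮(ℝ^m) and g ∈ 𝒮(ℝ^n) be Schwartz functions and define h : ℝ^{m+n} → ℂ by h(x, y) := f(x)·g(y). Then ‖⟨·⟩^s 𝓕h‖_{L²(ℝ^{m+n})} ≤ ‖⟨·⟩^{r'} 𝓕f‖_{L²(ℝ^m)} · ‖⟨·⟩^{r''} 𝓕g‖_{L²(ℝ^n)}, where 𝓕 denotes the Fourier transform (with the same normalization on each space). -/

import Mathlib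

open scoped ENNReal FourierTransform
open MeasureTheory

/-- The Japanese bracket `⟨x⟩ = (1 + |x|²)^(1/2)`. -/
noncomputable def jb {E : Type*} [NormedAddCommGroup E] (x : E) : ℝ :=
  Real.sqrt (1 + ‖x‖ ^ 2)

/-- First component of `z ∈ ℝ^(m+n)` under the identification `ℝ^(m+n) = ℝ^m × ℝ^n`. -/
noncomputable def fstE {m n : ℕ} (z : EuclideanSpace ℝ (Fin (m + n))) :
    EuclideanSpace ℝ (Fin m) :=
  (EuclideanSpace.equiv (Fin m) ℝ).symm (fun i => z (Fin.castAdd n i))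

/-- Second component of `z ∈ ℝ^(m+n)` under the identification `ℝ^(m+n) = ℝ^m × ℝ^n`. -/
noncomputable def sndE {m n : ℕ} (z : EuclideanSpace ℝ (Fin (m + n))) :
    EuclideanSpace ℝ (Fin n) :=
  (EuclideanSpace.equiv (Fin n) ℝ).symm (fun j => z (Fin.natAdd m j))

open scoped RealInnerProductSpace

lemma one_le_jb {E : Type*} [NormedAddCommGroup E] (x : E) : 1 ≤ jb x :=
  Real.one_le_sqrt.2 (by nlinarith [sq_nonneg ‖x‖])

lemma continuous_jb {E : Type*} [NormedAddCommGroup E] : Continuous (jb : E → ℝ) := by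
  unfold jb
  fun_prop

lemma measurable_jb_rpow_mul_nnnorm_sq {E F : Type*} [NormedAddCommGroup E] [MeasurableSpace E]
    [BorelSpace E] [NormedAddCommGroup F] {u : E → F} (hu : Continuous u) (r : ℝ) :
    Measurable fun x => ENNReal.ofReal (jb x ^ r) * (‖u x‖₊ : ℝ≥0∞) ^ 2 :=
  ((continuous_jb.measurable.pow_const r).ennreal_ofReal).mul
    (hu.nnnorm.measurable.coe_nnreal_ennreal.pow_const 2)

lemma inner_eq_inner_fstE_add_inner_sndE {m n : ℕ} (z w : EuclideanSpace ℝ (Fin (m + n))) :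
    ⟪z, w⟫ = ⟪fstE z, fstE w⟫ + ⟪sndE z, sndE w⟫ := by
  simp [PiLp.inner_apply, Fin.sum_univ_add, fstE, sndE]

lemma norm_sq_eq_norm_fstE_sq_add_norm_sndE_sq {m n : ℕ} (z : EuclideanSpace ℝ (Fin (m + n))) :
    ‖z‖ ^ 2 = ‖fstE z‖ ^ 2 + ‖sndE z‖ ^ 2 := by
  simpa only [real_inner_self_eq_norm_sq] using inner_eq_inner_fstE_add_inner_sndE z z

/-- The identification of `ℝ^(m+n)` with `ℝ^m × ℝ^n` as a measurable equivalence. -/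
noncomputable def splitEquiv (m n : ℕ) : EuclideanSpace ℝ (Fin (m + n)) ≃ᵐ
    EuclideanSpace ℝ (Fin m) × EuclideanSpace ℝ (Fin n) :=
  (LinearIsometryEquiv.piLpCongrLeft 2 ℝ ℝ finSumFinEquiv.symm).toMeasurableEquiv.trans <|
  (MeasurableEquiv.toLp 2 _).symm.trans <|
  (MeasurableEquiv.sumPiEquivProdPi (fun _ : Fin m ⊕ Fin n => ℝ)).trans <|
  MeasurableEquiv.prodCongr (MeasurableEquiv.toLp 2 _) (MeasurableEquiv.toLp 2 _)

lemma splitEquiv_apply {m n : ℕ} (z : EuclideanSpace ℝ (Fin (m + n))) :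
    splitEquiv m n z = (fstE z, sndE z) := rfl

lemma measurePreserving_splitEquiv (m n : ℕ) : MeasurePreserving (splitEquiv m n) := by
  refine (LinearIsometryEquiv.measurePreserving _).trans ?_
  refine (EuclideanSpace.volume_preserving_symm_measurableEquiv_toLp _).trans ?_
  refine (volume_measurePreserving_sumPiEquivProdPi _).trans ?_
  exact (EuclideanSpace.volume_preserving_symm_measurableEquiv_toLp _).symm.prod
    (EuclideanSpace.volume_preserving_symm_measurableEquiv_toLp _).symm

lemma fourier_tensor {m n : ℕ} (f : EuclideanSpace ℝ (Fin m) → ℂ)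
    (g : EuclideanSpace ℝ (Fin n) → ℂ) (ζ : EuclideanSpace ℝ (Fin (m + n))) :
    𝓕 (fun z => f (fstE z) * g (sndE z)) ζ = 𝓕 f (fstE ζ) * 𝓕 g (sndE ζ) := by
  simp only [Real.fourier_eq]
  rw [← integral_prod_mul, ← Measure.volume_eq_prod,
    ← (measurePreserving_splitEquiv m n).integral_comp (splitEquiv m n).measurableEmbedding]
  refine integral_congr_ae (.of_forall fun z => ?_)
  simp only [splitEquiv_apply, inner_eq_inner_fstE_add_inner_sndE z ζ, neg_add,
    AddChar.map_add_eq_mul, Circle.smul_def, Circle.coe_mul, smul_eq_mul]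
  ring

lemma rpow_le_rpow_mul_rpow {a b c s p q : ℝ} (ha : 1 ≤ a) (hb : 1 ≤ b) (hac : a ≤ c)
    (hbc : b ≤ c) (hab : c ≤ a * b) (h1 : s ≤ p + min 0 q) (h2 : s ≤ q + min 0 p) :
    c ^ s ≤ a ^ p * b ^ q := by
  have ha0 : 0 < a := by linarith
  have hb0 : 0 < b := by linarith
  have hc : 1 ≤ c := ha.trans hac
  have hc0 : 0 < c := by linarith
  rcases le_total 0 p with hp | hp <;> rcases le_total 0 q with hq | hq <;>
    simp only [min_eq_left, min_eq_right, hp, hq, add_zero] at h1 h2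
  · rcases le_total 0 s with hs | hs
    · calc c ^ s ≤ (a * b) ^ s := Real.rpow_le_rpow hc0.le hab hs
        _ = a ^ s * b ^ s := Real.mul_rpow ha0.le hb0.le
        _ ≤ a ^ p * b ^ q := by gcongr
    · exact (Real.rpow_le_one_of_one_le_of_nonpos hc hs).trans
        (one_le_mul_of_one_le_of_one_le (Real.one_le_rpow ha hp) (Real.one_le_rpow hb hq))
  · calc c ^ s ≤ c ^ q := Real.rpow_le_rpow_of_exponent_le hc h2
      _ ≤ b ^ q := Real.rpow_le_rpow_of_nonpos hb0 hbc hq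
      _ ≤ a ^ p * b ^ q := le_mul_of_one_le_left (by positivity) (Real.one_le_rpow ha hp)
  · calc c ^ s ≤ c ^ p := Real.rpow_le_rpow_of_exponent_le hc h1
      _ ≤ a ^ p := Real.rpow_le_rpow_of_nonpos ha0 hac hp
      _ ≤ a ^ p * b ^ q := le_mul_of_one_le_right (by positivity) (Real.one_le_rpow hb hq)
  · calc c ^ s ≤ c ^ (p + q) := Real.rpow_le_rpow_of_exponent_le hc h1
      _ = c ^ p * c ^ q := Real.rpow_add hc0 _ _
      _ ≤ a ^ p * b ^ q := mul_le_mul (Real.rpow_le_rpow_of_nonpos ha0 hac hp)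
          (Real.rpow_le_rpow_of_nonpos hb0 hbc hq) (by positivity) (by positivity)

lemma jb_rpow_le_mul {m n : ℕ} (z : EuclideanSpace ℝ (Fin (m + n))) {s p q : ℝ}
    (h1 : s ≤ p + min 0 q) (h2 : s ≤ q + min 0 p) :
    jb z ^ s ≤ jb (fstE z) ^ p * jb (sndE z) ^ q := by
  have hz := norm_sq_eq_norm_fstE_sq_add_norm_sndE_sq z
  refine rpow_le_rpow_mul_rpow (one_le_jb _) (one_le_jb _) (Real.sqrt_le_sqrt ?_)
    (Real.sqrt_le_sqrt ?_) ?_ h1 h2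
  · nlinarith [sq_nonneg ‖sndE z‖]
  · nlinarith [sq_nonneg ‖fstE z‖]
  · rw [jb, jb, jb, ← Real.sqrt_mul (by positivity)]
    refine Real.sqrt_le_sqrt ?_
    nlinarith [mul_nonneg (sq_nonneg ‖fstE z‖) (sq_nonneg ‖sndE z‖)]

theorem stmt_16 (m n : ℕ) (s r' r'' : ℝ)
    (h1 : s ≤ r' + min 0 r'') (h2 : s ≤ r'' + min 0 r')
    (f : SchwartzMap (EuclideanSpace ℝ (Fin m)) ℂ)
    (g : SchwartzMap (EuclideanSpace ℝ (Fin n)) ℂ)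
    (h : EuclideanSpace ℝ (Fin (m + n)) → ℂ)
    (hh : h = fun z => f (fstE z) * g (sndE z)) :
    (∫⁻ ζ, ENNReal.ofReal (jb ζ ^ (2 * s)) * (‖𝓕 h ζ‖₊ : ℝ≥0∞) ^ 2) ^ (1 / 2 : ℝ)
      ≤ (∫⁻ ξ, ENNReal.ofReal (jb ξ ^ (2 * r')) * (‖𝓕 (⇑f) ξ‖₊ : ℝ≥0∞) ^ 2) ^ (1 / 2 : ℝ)
        * (∫⁻ η, ENNReal.ofReal (jb η ^ (2 * r'')) * (‖𝓕 (⇑g) η‖₊ : ℝ≥0∞) ^ 2) ^ (1 / 2 : ℝ) := by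
  subst hh
  have hs {p q : ℝ} (hp : s ≤ p + min 0 q) : 2 * s ≤ 2 * p + min 0 (2 * q) := by
    rw [← mul_zero (2 : ℝ), ← mul_min_of_nonneg _ _ zero_le_two]
    linarith
  rw [← ENNReal.mul_rpow_of_nonneg _ _ (by norm_num)]
  gcongr
  have hf : Continuous (𝓕 (⇑f)) := (𝓕 f).continuous
  have hg : Continuous (𝓕 (⇑g)) := (𝓕 g).continuous
  rw [← lintegral_prod_mul (measurable_jb_rpow_mul_nnnorm_sq hf _).aemeasurable
      (measurable_jb_rpow_mul_nnnorm_sq hg _).aemeasurable, ← Measure.volume_eq_prod,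
    ← (measurePreserving_splitEquiv m n).lintegral_comp_emb (splitEquiv m n).measurableEmbedding]
  refine lintegral_mono fun ζ => ?_
  simp only [splitEquiv_apply, fourier_tensor, nnnorm_mul, ENNReal.coe_mul, mul_pow]
  rw [mul_mul_mul_comm, ← ENNReal.ofReal_mul (Real.rpow_nonneg (zero_le_one.trans (one_le_jb _)) _)]
  gcongr
  exact jb_rpow_le_mul ζ (hs h1) (hs h2)
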